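/- Let N ≥ 1, let c > 0, let ε ∈ (0,1) and δ ∈ (0,1), and set σ = √(2·log(1.25/δ))/ε (natural logarithm). For u ∈ ℝ^N, let μ_u denote the probability measure on ℝ^N obtained as the pushforward of the product measure ⊗_{k=0}^{N−1} gaussianReal 0 (c²σ²) under the map η ↦ (n ↦ Re((F⁻¹(u + η))_n)), where u + η ∈ ℝ^N is regarded as an element of ℂ^N. Then for all g, g' ∈ ℝ^N with ‖g − g'‖₂ ≤ c and every measurable set A ⊆ ℝ^N, μ_g(A) ≤ exp(ε)·μ_{g'}(A) + δ. -/

import Mathlib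

open MeasureTheory ProbabilityTheory

/-- The inverse unitary discrete Fourier transform on `ℂ^N`. -/
noncomputable def idft {N : ℕ} (z : Fin N → ℂ) : Fin N → ℂ := fun n =>
  (1 / (Real.sqrt N : ℂ)) *
    ∑ i : Fin N, z i * Complex.exp ((2 * (Real.pi : ℂ) * Complex.I * (i : ℕ) * (n : ℕ)) / N)

/-- The GReDP mechanism: add i.i.d. real Gaussian noise of variance `c²σ²` to `u` in the
frequency domain, apply the inverse Fourier transform, and keep the real parts. -/
noncomputable def gredpMech (N : ℕ) (c σ : ℝ) (u : Fin N → ℝ) : Measure (Fin N → ℝ) :=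
  Measure.map
    (fun η : Fin N → ℝ =>
      fun n : Fin N => (idft (fun i => ((u i + η i : ℝ) : ℂ)) n).re)
    (Measure.pi (fun _ : Fin N => gaussianReal 0 ((c ^ 2 * σ ^ 2).toNNReal)))

open scoped NNReal ENNReal

/-- One-dimensional Cameron–Martin formula. -/
lemma gaussian_shift_density (d : ℝ) {v : ℝ≥0} (hv : v ≠ 0) (s : Set ℝ) (hs : MeasurableSet s) :
    gaussianReal d v s
      = ∫⁻ x in s, ENNReal.ofReal (Real.exp ((x * d - d ^ 2 / 2) / v)) ∂(gaussianReal 0 v) := by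
  have hv' : (v : ℝ) ≠ 0 := by exact_mod_cast hv
  rw [gaussianReal_of_var_ne_zero 0 hv, gaussianReal_apply d hv,
    setLIntegral_withDensity_eq_setLIntegral_mul _ (measurable_gaussianPDF 0 v) (by fun_prop) hs]
  refine lintegral_congr fun x => ?_
  simp only [Pi.mul_apply, gaussianPDF]
  rw [← ENNReal.ofReal_mul (gaussianPDFReal_nonneg _ _ _)]
  congr 1
  simp only [gaussianPDFReal]
  conv_rhs => rw [mul_assoc, ← Real.exp_add]
  congr 2
  field_simp
  ring

/-- The half-line has standard Gaussian mass at most one half. -/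
lemma gaussian_half : gaussianReal 0 1 (Set.Ioi 0) ≤ ENNReal.ofReal (1 / 2) := by
  have h1 : gaussianReal 0 1 (Set.Iio 0) = gaussianReal 0 1 (Set.Ioi 0) := by
    have h := gaussianReal_map_neg (μ := 0) (v := 1)
    rw [neg_zero] at h
    conv_lhs => rw [← h]
    rw [Measure.map_apply (by fun_prop) measurableSet_Iio]
    congr 1
    ext x
    simp
  have h2 : gaussianReal 0 1 (Set.Ioi (0:ℝ)) + gaussianReal 0 1 (Set.Ioi (0:ℝ)) ≤ 1 := by
    nth_rewrite 1 [← h1]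
    rw [← measure_union (by
      rw [Set.disjoint_left]; intro x hx hx'; simp only [Set.mem_Iio, Set.mem_Ioi] at *; linarith)
      measurableSet_Ioi]
    exact prob_le_one
  have hfin : gaussianReal 0 1 (Set.Ioi (0:ℝ)) ≠ ∞ := measure_ne_top _ _
  rw [ENNReal.le_ofReal_iff_toReal_le hfin (by norm_num)]
  have h3 := ENNReal.toReal_mono (by simp) h2
  rw [ENNReal.toReal_add hfin hfin, ENNReal.toReal_one] at h3
  linarith

lemma gaussian_tail_nonneg (t : ℝ) (ht : 0 ≤ t) :
    gaussianReal 0 1 (Set.Ioi t) ≤ ENNReal.ofReal (1 / 2 * Real.exp (-t ^ 2 / 2)) := by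
  have h1 : gaussianReal 0 1 (Set.Ioi t) = gaussianReal (-t) 1 (Set.Ioi 0) := by
    have h := gaussianReal_map_add_const (μ := 0) (v := 1) (-t)
    rw [zero_add] at h
    rw [← h, Measure.map_apply (by fun_prop) measurableSet_Ioi]
    congr 1
    ext x
    simp
  rw [h1, gaussian_shift_density (-t) one_ne_zero _ measurableSet_Ioi]
  calc ∫⁻ x in Set.Ioi 0, ENNReal.ofReal (Real.exp ((x * (-t) - (-t) ^ 2 / 2) / (1 : ℝ≥0)))
        ∂(gaussianReal 0 1)
      ≤ ∫⁻ x in Set.Ioi 0, ENNReal.ofReal (Real.exp (-t ^ 2 / 2)) ∂(gaussianReal 0 1) := by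
        refine setLIntegral_mono (by fun_prop) fun x hx => ?_
        have hx : 0 < x := hx
        refine ENNReal.ofReal_le_ofReal (Real.exp_le_exp.2 ?_)
        simp only [NNReal.coe_one, div_one]
        nlinarith [mul_nonneg hx.le ht]
    _ = ENNReal.ofReal (Real.exp (-t ^ 2 / 2)) * gaussianReal 0 1 (Set.Ioi 0) := by
        rw [setLIntegral_const]
    _ ≤ ENNReal.ofReal (Real.exp (-t ^ 2 / 2)) * ENNReal.ofReal (1 / 2) := by
        gcongr; exact gaussian_half
    _ = _ := by
        rw [← ENNReal.ofReal_mul (Real.exp_pos _).le, mul_comm]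

lemma gaussian_tail_neg (t : ℝ) (ht : t ≤ 0) :
    gaussianReal 0 1 (Set.Ioi t) ≤ ENNReal.ofReal (1 / 2 - t) := by
  rw [← Set.Ioc_union_Ioi_eq_Ioi ht]
  refine (measure_union_le _ _).trans ?_
  have h1 : gaussianReal 0 1 (Set.Ioc t 0) ≤ ENNReal.ofReal (-t) := by
    rw [gaussianReal_apply 0 one_ne_zero]
    calc ∫⁻ x in Set.Ioc t 0, gaussianPDF 0 1 x ≤ ∫⁻ x in Set.Ioc t 0, 1 := by
          refine setLIntegral_mono (by fun_prop) fun x _ => ?_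
          rw [gaussianPDF, ← ENNReal.ofReal_one]
          refine ENNReal.ofReal_le_ofReal ?_
          rw [gaussianPDFReal]
          refine mul_le_one₀ (inv_le_one_of_one_le₀ ?_) (Real.exp_pos _).le
            (Real.exp_le_one_iff.2 ?_)
          · rw [Real.one_le_sqrt]
            have := Real.pi_gt_three
            simp only [NNReal.coe_one]
            linarith
          · simp only [NNReal.coe_one]
            nlinarith [sq_nonneg (x - 0)]
      _ = _ := by simp
  calc _ ≤ ENNReal.ofReal (-t) + ENNReal.ofReal (1 / 2) := add_le_add h1 gaussian_half
    _ = _ := by rw [← ENNReal.ofReal_add (by linarith) (by norm_num)]; congr 1; ring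

/-- The tail bound behind the Gaussian mechanism. -/
lemma gaussian_tail_delta (ε δ a : ℝ) (hε : ε ∈ Set.Ioo (0 : ℝ) 1) (hδ : δ ∈ Set.Ioo (0 : ℝ) 1)
    (ha : a = Real.sqrt (2 * Real.log (1.25 / δ))) :
    0 < a ∧ gaussianReal 0 1 (Set.Ioi (a - ε / (2 * a))) ≤ ENNReal.ofReal δ := by
  obtain ⟨hε0, hε1⟩ := hε
  obtain ⟨hδ0, hδ1⟩ := hδ
  have hq : 0 < 1.25 / δ := by positivity
  have hlog : 1 / 5 ≤ Real.log (1.25 / δ) := by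
    have := Real.one_sub_inv_le_log_of_pos hq
    rw [inv_div] at this
    have : δ / 1.25 ≤ 4 / 5 := by rw [div_le_iff₀ (by norm_num)]; norm_num; exact hδ1.le
    linarith
  have ha2 : a ^ 2 = 2 * Real.log (1.25 / δ) := by
    rw [ha, Real.sq_sqrt (by linarith)]
  have ha0 : 0 < a := by rw [ha]; apply Real.sqrt_pos.2; linarith
  have hd : δ = 1.25 * Real.exp (-a ^ 2 / 2) := by
    have : -a ^ 2 / 2 = - Real.log (1.25 / δ) := by rw [neg_div, ha2]; ring
    rw [this, Real.exp_neg, Real.exp_log hq]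
    field_simp
  refine ⟨ha0, ?_⟩
  set t := a - ε / (2 * a) with ht
  rcases le_total 0 t with h0 | h0
  · refine (gaussian_tail_nonneg t h0).trans (ENNReal.ofReal_le_ofReal ?_)
    have h1 : -t ^ 2 / 2 ≤ 1 / 2 + (-a ^ 2 / 2) := by
      have : t ^ 2 = a ^ 2 - ε + (ε / (2 * a)) ^ 2 := by rw [ht]; field_simp; ring
      nlinarith [sq_nonneg (ε / (2 * a))]
    have h2 : Real.exp (1 / 2) ≤ 2 := by
      have h3 : Real.exp (1 / 2) * Real.exp (1 / 2) = Real.exp 1 := by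
        rw [← Real.exp_add]; norm_num
      nlinarith [Real.exp_one_lt_d9, Real.exp_pos (1 / 2)]
    calc 1 / 2 * Real.exp (-t ^ 2 / 2) ≤ 1 / 2 * Real.exp (1 / 2 + (-a ^ 2 / 2)) := by gcongr
      _ = 1 / 2 * Real.exp (1 / 2) * Real.exp (-a ^ 2 / 2) := by rw [Real.exp_add]; ring
      _ ≤ 1.25 * Real.exp (-a ^ 2 / 2) := by gcongr; linarith
      _ = δ := hd.symm
  · refine (gaussian_tail_neg t h0).trans (ENNReal.ofReal_le_ofReal ?_)
    have h1 := Real.add_one_le_exp (-a ^ 2 / 2)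
    have h2 : ε / (2 * a) * (2 * a) = ε := by field_simp
    have h3 : a ^ 2 ≤ 1 / 2 := by nlinarith
    have h4 : 0.6 ≤ a := by nlinarith
    have h5 : ε / (2 * a) ≤ 0.9 := by rw [div_le_iff₀ (by positivity)]; linarith
    linarith

/-- The law of a linear functional of i.i.d. centred Gaussians. -/
lemma gaussian_pi_map_linear {N : ℕ} (d : Fin N → ℝ) (v : ℝ≥0) :
    (Measure.pi (fun _ : Fin N => gaussianReal 0 v)).map (fun η => ∑ i, η i * d i)
      = gaussianReal 0 (v * (∑ i, d i ^ 2).toNNReal) := by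
  have hm : Measurable (fun η : Fin N → ℝ => ∑ i, η i * d i) := by fun_prop
  have : IsProbabilityMeasure
    ((Measure.pi (fun _ : Fin N => gaussianReal 0 v)).map (fun η => ∑ i, η i * d i)) :=
    Measure.isProbabilityMeasure_map hm.aemeasurable
  apply Measure.ext_of_charFun
  ext t
  rw [charFun_gaussianReal, charFun_apply_real, integral_map hm.aemeasurable (by fun_prop)]
  have h1 : ∀ η : Fin N → ℝ, Complex.exp (t * ((∑ i, η i * d i : ℝ) : ℂ) * Complex.I)
      = ∏ i, Complex.exp (((t * d i : ℝ) : ℂ) * (η i : ℂ) * Complex.I) := by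
    intro η
    rw [← Complex.exp_sum]
    congr 1
    push_cast
    rw [Finset.mul_sum, Finset.sum_mul]
    refine Finset.sum_congr rfl fun i _ => by ring
  simp_rw [h1]
  rw [integral_fintype_prod_eq_prod
    (f := fun i (x : ℝ) => Complex.exp (((t * d i : ℝ) : ℂ) * (x : ℂ) * Complex.I))]
  have h2 : ∀ i, ∫ x, Complex.exp (((t * d i : ℝ) : ℂ) * (x : ℂ) * Complex.I) ∂(gaussianReal 0 v)
      = Complex.exp (-(v * ((t * d i : ℝ) : ℂ) ^ 2 / 2)) := by
    intro i
    rw [← charFun_apply_real, charFun_gaussianReal]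
    simp
  simp_rw [h2]
  rw [← Complex.exp_sum]
  congr 1
  have h3 : ((∑ i, d i ^ 2).toNNReal : ℝ) = ∑ i, d i ^ 2 :=
    Real.coe_toNNReal _ (Finset.sum_nonneg fun i _ => sq_nonneg _)
  have h4 : (((v * (∑ i, d i ^ 2).toNNReal : ℝ≥0) : ℝ) : ℂ) = v * ∑ i, (d i : ℂ) ^ 2 := by
    rw [NNReal.coe_mul, h3]; push_cast; rfl
  rw [h4, Finset.mul_sum, Finset.sum_mul, Finset.sum_div]
  simp only [Complex.ofReal_zero, mul_zero, zero_mul, zero_sub]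
  rw [← Finset.sum_neg_distrib]
  refine Finset.sum_congr rfl fun i _ => ?_
  push_cast
  ring

/-- Cameron–Martin formula for i.i.d. Gaussians. -/
lemma gaussian_pi_shift {N : ℕ} (d : Fin N → ℝ) {v : ℝ≥0} (hv : v ≠ 0) :
    Measure.pi (fun i : Fin N => gaussianReal (d i) v)
      = (Measure.pi (fun _ : Fin N => gaussianReal 0 v)).withDensity
        (fun η => ∏ i, ENNReal.ofReal (Real.exp ((η i * d i - d i ^ 2 / 2) / v))) := by
  refine Measure.pi_eq fun s hs => ?_
  have hS : MeasurableSet (Set.univ.pi s) := MeasurableSet.univ_pi hs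
  rw [withDensity_apply _ hS, ← lintegral_indicator hS]
  let F : Fin N → ℝ → ℝ≥0∞ := fun i => (s i).indicator
    fun x => ENNReal.ofReal (Real.exp ((x * d i - d i ^ 2 / 2) / v))
  have hF : ∀ i, Measurable (F i) := fun i => Measurable.indicator (by fun_prop) (hs i)
  have h1 : ∀ η : Fin N → ℝ, (Set.univ.pi s).indicator
      (fun η => ∏ i, ENNReal.ofReal (Real.exp ((η i * d i - d i ^ 2 / 2) / v))) η
      = ∏ i, F i (η i) := by
    intro η
    by_cases h : η ∈ Set.univ.pi s
    · rw [Set.indicator_of_mem h]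
      refine Finset.prod_congr rfl fun i _ => ?_
      simp only [F]
      rw [Set.indicator_of_mem (h i (Set.mem_univ i))]
    · rw [Set.indicator_of_notMem h]
      simp only [Set.mem_pi, Set.mem_univ, true_imp_iff, not_forall] at h
      obtain ⟨i, hi⟩ := h
      symm
      refine Finset.prod_eq_zero (Finset.mem_univ i) ?_
      exact Set.indicator_of_notMem hi _
  simp_rw [h1]
  have hind : iIndepFun (fun i (η : Fin N → ℝ) => F i (η i))
      (Measure.pi (fun _ : Fin N => gaussianReal 0 v)) :=
    iIndepFun_pi (fun i => (hF i).aemeasurable)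
  have h2 := lintegral_prod_eq_prod_lintegral_of_indepFun Finset.univ _ hind
    (fun i => (hF i).comp (measurable_pi_apply i))
  rw [h2]
  refine Finset.prod_congr rfl fun i _ => ?_
  rw [gaussian_shift_density (d i) hv _ (hs i), ← lintegral_indicator (hs i)]
  exact (measurePreserving_eval (fun _ : Fin N => gaussianReal 0 v) i).lintegral_comp (hF i)

/-- The Gaussian mechanism on `ℝ^N`, for measurable sets. -/
lemma gaussian_mech {N : ℕ} (c : ℝ) (hc : 0 < c)
    (ε δ : ℝ) (hε : ε ∈ Set.Ioo (0 : ℝ) 1) (hδ : δ ∈ Set.Ioo (0 : ℝ) 1)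
    (σ : ℝ) (hσ : σ = Real.sqrt (2 * Real.log (1.25 / δ)) / ε)
    (d : Fin N → ℝ) (hd : Real.sqrt (∑ n : Fin N, (d n) ^ 2) ≤ c)
    (B : Set (Fin N → ℝ)) (hB : MeasurableSet B) :
    Measure.pi (fun _ : Fin N => gaussianReal 0 ((c ^ 2 * σ ^ 2).toNNReal))
        ((fun η i => η i + d i) ⁻¹' B)
      ≤ ENNReal.ofReal (Real.exp ε) *
          Measure.pi (fun _ : Fin N => gaussianReal 0 ((c ^ 2 * σ ^ 2).toNNReal)) B
        + ENNReal.ofReal δ := by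
  obtain ⟨ha0, htail⟩ := gaussian_tail_delta ε δ _ hε hδ rfl
  set a := Real.sqrt (2 * Real.log (1.25 / δ)) with ha
  obtain ⟨hε0, hε1⟩ := hε
  have hσ0 : 0 < σ := by rw [hσ]; positivity
  have haσ : a = σ * ε := by rw [hσ]; field_simp
  have hv0 : 0 < c ^ 2 * σ ^ 2 := by positivity
  set v : ℝ≥0 := (c ^ 2 * σ ^ 2).toNNReal with hvdef
  have hvR : (v : ℝ) = c ^ 2 * σ ^ 2 := Real.coe_toNNReal _ hv0.le
  have hv : v ≠ 0 := by
    intro h; rw [h] at hvR; simp only [NNReal.coe_zero] at hvR; linarith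
  set P := Measure.pi (fun _ : Fin N => gaussianReal 0 v) with hP
  set D := Real.sqrt (∑ n : Fin N, (d n) ^ 2) with hD
  have hDsum : ∑ n : Fin N, (d n) ^ 2 = D ^ 2 := by
    rw [hD, Real.sq_sqrt (Finset.sum_nonneg fun i _ => sq_nonneg _)]
  have hD0 : 0 ≤ D := Real.sqrt_nonneg _
  have hshm : Measurable (fun (η : Fin N → ℝ) i => η i + d i) := by fun_prop
  have hmap : P.map (fun η i => η i + d i) = Measure.pi (fun i : Fin N => gaussianReal (d i) v) := by
    rw [hP, Measure.pi_map_pi (f := fun i x => x + d i) (fun i => by fun_prop)]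
    congr 1
    ext1 i
    rw [gaussianReal_map_add_const, zero_add]
  let G : Set (Fin N → ℝ) := {η | (∑ i, η i * d i) ≤ v * ε + D ^ 2 / 2}
  have hG : MeasurableSet G := measurableSet_le (by fun_prop) measurable_const
  have hgood : P ((fun η i => η i + d i) ⁻¹' (B ∩ G)) ≤ ENNReal.ofReal (Real.exp ε) * P B := by
    rw [← Measure.map_apply hshm (hB.inter hG), hmap, gaussian_pi_shift d hv,
      withDensity_apply _ (hB.inter hG)]
    calc _ ≤ ∫⁻ η in B ∩ G, ENNReal.ofReal (Real.exp ε) ∂P := by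
          refine setLIntegral_mono (by fun_prop) fun η hη => ?_
          rw [← ENNReal.ofReal_prod_of_nonneg (fun i _ => (Real.exp_pos _).le), ← Real.exp_sum]
          refine ENNReal.ofReal_le_ofReal (Real.exp_le_exp.2 ?_)
          rw [← Finset.sum_div, Finset.sum_sub_distrib, ← Finset.sum_div, hDsum,
            div_le_iff₀ (by rw [hvR]; exact hv0)]
          have h : (∑ i, η i * d i) ≤ v * ε + D ^ 2 / 2 := hη.2
          linarith
      _ = ENNReal.ofReal (Real.exp ε) * P (B ∩ G) := by rw [setLIntegral_const]
      _ ≤ _ := by gcongr; exact Set.inter_subset_left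
  have hbad : P ((fun η i => η i + d i) ⁻¹' Gᶜ) ≤ ENNReal.ofReal δ := by
    have h1 : (fun (η : Fin N → ℝ) i => η i + d i) ⁻¹' Gᶜ
        = (fun η => ∑ i, η i * d i) ⁻¹' (Set.Ioi (v * ε - D ^ 2 / 2)) := by
      ext η
      simp only [G, Set.mem_preimage, Set.mem_compl_iff, Set.mem_setOf_eq, not_le, Set.mem_Ioi,
        add_mul, Finset.sum_add_distrib]
      have : ∑ i, d i * d i = D ^ 2 := by
        rw [← hDsum]; exact Finset.sum_congr rfl fun i _ => by ring
      rw [this]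
      constructor <;> intro h <;> linarith
    rw [h1, ← Measure.map_apply (by fun_prop) measurableSet_Ioi, gaussian_pi_map_linear, hDsum]
    have h2 : gaussianReal 0 (v * (D ^ 2).toNNReal)
        = (gaussianReal 0 1).map (fun x => (c * σ * D) * x) := by
      rw [gaussianReal_map_const_mul]
      congr 1
      · simp
      · ext
        rw [NNReal.coe_mul, hvR, Real.coe_toNNReal _ (sq_nonneg D)]
        simp
        ring
    rw [h2, Measure.map_apply (by fun_prop) measurableSet_Ioi]
    refine le_trans (measure_mono ?_) htail
    intro x hx
    simp only [Set.mem_preimage, Set.mem_Ioi] at hx ⊢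
    by_contra hcon
    push Not at hcon
    have h3 : c * σ * D * x ≤ c * σ * D * (a - ε / (2 * a)) := by gcongr
    have h4 : c * σ * D * (a - ε / (2 * a)) = c * D * σ ^ 2 * ε - c * D / 2 := by
      rw [haσ]; field_simp
    have h5 : c * D * σ ^ 2 * ε ≤ c * c * σ ^ 2 * ε := by gcongr
    have h6 : D * D ≤ c * D := by gcongr
    rw [hvR] at hx
    nlinarith
  calc P ((fun η i => η i + d i) ⁻¹' B)
      ≤ P ((fun η i => η i + d i) ⁻¹' (B ∩ G) ∪ (fun η i => η i + d i) ⁻¹' Gᶜ) := by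
        refine measure_mono fun η hη => ?_
        by_cases h : (fun i => η i + d i) ∈ G
        · exact Or.inl ⟨hη, h⟩
        · exact Or.inr h
    _ ≤ _ := measure_union_le _ _
    _ ≤ _ := add_le_add hgood hbad

/-- Theorem 3 of the paper: the GReDP mechanism is `(ε, δ)`-differentially private when
`σ = √(2 log(1.25/δ))/ε`, for inputs at Euclidean distance at most `c` (the sensitivity). -/
theorem gredp_dp (N : ℕ) (hN : 1 ≤ N) (c : ℝ) (hc : 0 < c)
    (ε δ : ℝ) (hε : ε ∈ Set.Ioo (0 : ℝ) 1) (hδ : δ ∈ Set.Ioo (0 : ℝ) 1)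
    (σ : ℝ) (hσ : σ = Real.sqrt (2 * Real.log (1.25 / δ)) / ε)
    (g g' : Fin N → ℝ) (hgg' : Real.sqrt (∑ n : Fin N, (g n - g' n) ^ 2) ≤ c)
    (A : Set (Fin N → ℝ)) (hA : MeasurableSet A) :
    gredpMech N c σ g A ≤ ENNReal.ofReal (Real.exp ε) * gredpMech N c σ g' A
      + ENNReal.ofReal δ := by
  have hT : ∀ u : Fin N → ℝ, Measurable (fun η : Fin N → ℝ =>
      fun n : Fin N => (idft (fun i => ((u i + η i : ℝ) : ℂ)) n).re) := by
    intro u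
    refine measurable_pi_lambda _ fun n => ?_
    unfold idft
    fun_prop
  have h := gaussian_mech c hc ε δ hε hδ σ hσ (fun i => g i - g' i) hgg' _ (hT g' hA)
  unfold gredpMech
  rw [Measure.map_apply (hT g) hA, Measure.map_apply (hT g') hA]
  convert h using 2
  ext η
  have : ∀ i, g' i + (η i + (g i - g' i)) = g i + η i := fun i => by ring
  simp only [Set.mem_preimage, this]
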